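/- arXiv:1908.03294 — 3 statements merged into one kernel-verified Lean document; each statement's English description precedes it below -/
import Mathlib

section
/- For every integer n ≥ 2, the largest minimum weight d₃(n,2) among all ternary LCD [n,2] codes equals ⌊3n/4⌋ if n ≡ 1 or 2 (mod 4), and equals ⌊3n/4⌋ − 1 if n ≡ 0 or 3 (mod 4). -/
open Matrix Finset

/-- The (Hamming) weight of a vector. -/
def wt {R : Type*} [Zero R] [DecidableEq R] {n : ℕ} (x : Fin n → R) : ℕ :=
  (Finset.univ.filter fun i => x i ≠ 0).card

/-- The dual code of a linear code, w.r.t. the standard inner product. -/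
def dualCode {R : Type*} [CommRing R] {n : ℕ} (C : Submodule R (Fin n → R)) :
    Submodule R (Fin n → R) where
  carrier := {x | ∀ y ∈ C, ∑ i, x i * y i = 0}
  add_mem' := by
    intro a b ha hb y hy
    have ha' := ha y hy
    have hb' := hb y hy
    simp only [Set.mem_setOf_eq, Pi.add_apply, add_mul, Finset.sum_add_distrib, ha', hb',
      add_zero]
  zero_mem' := by intro y hy; simp
  smul_mem' := by
    intro c x hx y hy
    have h := hx y hy
    simp only [Set.mem_setOf_eq, Pi.smul_apply, smul_eq_mul, mul_assoc, ← Finset.mul_sum, h,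
      mul_zero]

/-- A linear code is LCD if it intersects its dual trivially. -/
def IsLCD {R : Type*} [CommRing R] {n : ℕ} (C : Submodule R (Fin n → R)) : Prop :=
  C ⊓ dualCode C = ⊥

/-- `C` has minimum weight `d`. -/
def HasMinWeight {R : Type*} [CommRing R] [DecidableEq R] {n : ℕ}
    (C : Submodule R (Fin n → R)) (d : ℕ) : Prop :=
  (∃ x ∈ C, x ≠ 0 ∧ wt x = d) ∧ ∀ x ∈ C, x ≠ 0 → d ≤ wt x

/-- The dual distance of `C` is at least `d`. -/
def DualDistGe {R : Type*} [CommRing R] [DecidableEq R] {n : ℕ}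
    (C : Submodule R (Fin n → R)) (d : ℕ) : Prop :=
  ∀ x ∈ dualCode C, x ≠ 0 → d ≤ wt x

/-- A monomial matrix: exactly one nonzero entry in each row and column. -/
def IsMonomial {R : Type*} [CommRing R] {n : ℕ} (P : Matrix (Fin n) (Fin n) R) : Prop :=
  ∃ (σ : Equiv.Perm (Fin n)) (c : Fin n → R), (∀ i, c i ≠ 0) ∧
    ∀ i j, P i j = if σ i = j then c i else 0

/-- Two codes of the same length are equivalent if one is the image of the other
under (right) multiplication by a monomial matrix. -/
def codeEquiv {R : Type*} [CommRing R] {n : ℕ} (C₁ C₂ : Submodule R (Fin n → R)) : Prop :=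
  ∃ P : Matrix (Fin n) (Fin n) R, IsMonomial P ∧ C₂ = C₁.map (Matrix.vecMulLinear P)

/-- `G` is a generator matrix of `C`: the rows of `G` form a basis of `C`. -/
def IsGenMatrix {R : Type*} [CommRing R] {k n : ℕ} (C : Submodule R (Fin n → R))
    (G : Matrix (Fin k) (Fin n) R) : Prop :=
  LinearIndependent R (fun i : Fin k => G i) ∧
    Submodule.span R (Set.range fun i : Fin k => G i) = C

/-- The code generated by the rows of a matrix. -/
def rowSpace {R : Type*} [CommRing R] {k n : ℕ} (G : Matrix (Fin k) (Fin n) R) :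
    Submodule R (Fin n → R) :=
  Submodule.span R (Set.range fun i : Fin k => G i)

/-- `[k]_q = (q^k - 1)/(q - 1) = 1 + q + ⋯ + q^(k-1)`. -/
def qrep (q k : ℕ) : ℕ := ∑ i ∈ Finset.range k, q ^ i

/-- The columns of the simplex-code generator matrix `S_{q,k}`, defined inductively. -/
def simplexCol (q : ℕ) : (k : ℕ) → ℕ → (Fin k → ZMod q)
  | 0, _ => fun i => i.elim0
  | (k+1), j =>
    if j < qrep q k then Fin.snoc (simplexCol q k j) 0
    else if j = qrep q k then Fin.snoc (fun _ => 0) 1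
    else Fin.snoc (simplexCol q k ((j - qrep q k - 1) % qrep q k))
      (((j - qrep q k - 1) / qrep q k + 1 : ℕ) : ZMod q)

/-- The generator matrix `S_{q,k}` of the simplex code. -/
def simplexMatrix (q k : ℕ) : Matrix (Fin k) (Fin (qrep q k)) (ZMod q) :=
  Matrix.of fun i j => simplexCol q k (j : ℕ) i

/-- Juxtaposition `(A | B)` of two matrices. -/
def hcat {R : Type*} {k a b : ℕ} (A : Matrix (Fin k) (Fin a) R) (B : Matrix (Fin k) (Fin b) R) :
    Matrix (Fin k) (Fin (a + b)) R :=
  Matrix.of fun i j =>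
    if h : (j : ℕ) < a then A i ⟨j, h⟩ else B i ⟨(j : ℕ) - a, by have := j.isLt; omega⟩

/-- `A^{(s)}`: juxtaposition of `s` copies of `A`. -/
def reps {R : Type*} {k r : ℕ} (A : Matrix (Fin k) (Fin r) R) (s : ℕ) :
    Matrix (Fin k) (Fin (r * s)) R :=
  Matrix.of fun i j => A i ⟨(j : ℕ) % r,
    Nat.mod_lt _ (Nat.pos_of_ne_zero fun hr => by subst hr; simpa using j.isLt)⟩

/-- The list of columns of `G_{q,k}(m)`: `m i` copies of the `i`-th column of `S_{q,k}`. -/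
def colList (q k : ℕ) (m : Fin (qrep q k) → ℕ) : List (Fin k → ZMod q) :=
  (List.finRange (qrep q k)).flatMap fun i => List.replicate (m i) (simplexCol q k (i : ℕ))

lemma colList_length (q k : ℕ) (m : Fin (qrep q k) → ℕ) :
    (colList q k m).length = ∑ i, m i := by
  simp [colList, List.length_flatMap, Function.comp_def]
  rw [← List.ofFn_eq_map, List.sum_ofFn]

/-- The matrix `G_{q,k}(m)`, consisting of `m i` copies of the `i`-th column of `S_{q,k}`. -/
def Gqk (q k : ℕ) (m : Fin (qrep q k) → ℕ) : Matrix (Fin k) (Fin (∑ i, m i)) (ZMod q) :=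
  Matrix.of fun i j => (colList q k m).get (Fin.cast (colList_length q k m).symm j) i

/-- The claimed value of `d₃(n,2)`. -/
def d3n2 (n : ℕ) : ℕ :=
  if n % 4 = 1 ∨ n % 4 = 2 then 3 * n / 4 else 3 * n / 4 - 1

/-- The Gram determinant of a pair of ternary vectors, expressed by weights. -/
def weightGram {n : ℕ} (u v : Fin n → ZMod 3) : ZMod 3 :=
  wt u * wt v - ((wt (u + v) : ZMod 3) - wt (u - v)) ^ 2

lemma cast_wt {n : ℕ} (x : Fin n → ZMod 3) : (wt x : ZMod 3) = x ⬝ᵥ x := by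
  have key : ∀ a : ZMod 3, (if a ≠ 0 then 1 else 0) = a * a := by decide
  simp only [wt, Finset.card_filter, Nat.cast_sum, dotProduct, ← key]
  simp

lemma dotProduct_eq_wt_sub_wt {n : ℕ} (u v : Fin n → ZMod 3) :
    u ⬝ᵥ v = (wt (u + v) : ZMod 3) - wt (u - v) := by
  have key : ∀ a d b : ZMod 3, d = a + d + (d + b) - (a - d - (d - b)) := by decide
  rw [cast_wt, cast_wt, add_dotProduct, sub_dotProduct, dotProduct_add, dotProduct_add,
    dotProduct_sub, dotProduct_sub, dotProduct_comm v u]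
  exact key _ _ _

lemma wt_neg {n : ℕ} (x : Fin n → ZMod 3) : wt (-x) = wt x := by
  simp [wt]

lemma wt_zero {n : ℕ} : wt (0 : Fin n → ZMod 3) = 0 := by
  simp [wt]

/-- Each coordinate is nonzero in none or in exactly three of `u`, `v`, `u + v`, `u - v`. -/
lemma exists_sum_wt_eq {n : ℕ} (u v : Fin n → ZMod 3) :
    ∃ k ≤ n, wt u + wt v + wt (u + v) + wt (u - v) = 3 * k := by
  have key : ∀ a b : ZMod 3, (if a ≠ 0 then 1 else 0) + (if b ≠ 0 then 1 else 0) +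
      (if a + b ≠ 0 then 1 else 0) + (if a - b ≠ 0 then 1 else 0) =
      3 * (if a ≠ 0 ∨ b ≠ 0 then 1 else 0) := by decide
  refine ⟨(univ.filter fun i => u i ≠ 0 ∨ v i ≠ 0).card,
    (card_filter_le _ _).trans (by simp), ?_⟩
  simp only [wt, card_filter, Pi.add_apply, Pi.sub_apply, ← sum_add_distrib, mul_sum, key]

lemma le_wt_of_mem_pair {n d : ℕ} {u v : Fin n → ZMod 3} (hu : d ≤ wt u) (hv : d ≤ wt v)
    (ha : d ≤ wt (u + v)) (hs : d ≤ wt (u - v)) (x y : ZMod 3) (hxy : x ≠ 0 ∨ y ≠ 0) :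
    d ≤ wt (x • u + y • v) := by
  have key : ∀ z : ZMod 3, z = 0 ∨ z = 1 ∨ z = -1 := by decide
  have h₁ : wt (-u + v) = wt (u - v) := by rw [← wt_neg]; congr 1; abel
  have h₂ : wt (-u - v) = wt (u + v) := by rw [← wt_neg]; congr 1; abel
  rcases key x with rfl | rfl | rfl <;> rcases key y with rfl | rfl | rfl <;>
    simp_all [wt_neg, ← sub_eq_add_neg]

/-- A ternary code with basis `u`, `v` is LCD iff the Gram determinant does not vanish. -/
lemma isLCD_span_pair_iff {n : ℕ} {u v : Fin n → ZMod 3}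
    (h : LinearIndependent (ZMod 3) ![u, v]) :
    IsLCD (Submodule.span (ZMod 3) {u, v}) ↔ weightGram u v ≠ 0 := by
  have mem_dual (x y : ZMod 3) : x • u + y • v ∈ dualCode (Submodule.span (ZMod 3) {u, v}) ↔
      x * (u ⬝ᵥ u) + y * (u ⬝ᵥ v) = 0 ∧ x * (u ⬝ᵥ v) + y * (v ⬝ᵥ v) = 0 := by
    have hu : (x • u + y • v) ⬝ᵥ u = x * (u ⬝ᵥ u) + y * (u ⬝ᵥ v) := by
      simp [add_dotProduct, dotProduct_comm v u]
    have hv : (x • u + y • v) ⬝ᵥ v = x * (u ⬝ᵥ v) + y * (v ⬝ᵥ v) := by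
      simp [add_dotProduct]
    rw [← hu, ← hv]
    constructor
    · intro hw
      exact ⟨hw u (Submodule.mem_span_of_mem (by simp)),
        hw v (Submodule.mem_span_of_mem (by simp))⟩
    · rintro ⟨h₁, h₂⟩ z hz
      obtain ⟨a, b, rfl⟩ := Submodule.mem_span_pair.1 hz
      change (x • u + y • v) ⬝ᵥ (a • u + b • v) = 0
      rw [dotProduct_add, dotProduct_smul, dotProduct_smul, h₁, h₂]
      simp
  rw [LinearIndependent.pair_iff] at h
  rw [weightGram, ← dotProduct_eq_wt_sub_wt, cast_wt, cast_wt, IsLCD, Submodule.eq_bot_iff]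
  constructor
  · intro hC hdet
    have key : ∀ a b d : ZMod 3, a * b - d ^ 2 = 0 →
        ∃ x y, (x ≠ 0 ∨ y ≠ 0) ∧ x * a + y * d = 0 ∧ x * d + y * b = 0 := by decide
    obtain ⟨x, y, hxy, hd⟩ := key _ _ _ hdet
    obtain ⟨hx, hy⟩ := h x y
      (hC _ ⟨Submodule.mem_span_pair.2 ⟨x, y, rfl⟩, (mem_dual x y).2 hd⟩)
    exact hxy.elim (· hx) (· hy)
  · rintro hdet w ⟨hw, hw'⟩
    have key : ∀ a b d : ZMod 3, a * b - d ^ 2 ≠ 0 →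
        ∀ x y, x * a + y * d = 0 → x * d + y * b = 0 → x = 0 ∧ y = 0 := by decide
    obtain ⟨x, y, rfl⟩ := Submodule.mem_span_pair.1 hw
    obtain ⟨h₁, h₂⟩ := (mem_dual x y).1 hw'
    obtain ⟨rfl, rfl⟩ := key _ _ _ hdet x y h₁ h₂
    simp

lemma wt_comp_equiv {n : ℕ} {S : Type*} [Fintype S] (f : Fin n ≃ S) (g : S → ZMod 3) :
    wt (g ∘ f) = ∑ s, if g s ≠ 0 then 1 else 0 := by
  rw [wt, card_filter, ← f.sum_comp]
  rfl

/-- Weights of the two rows of a matrix with prescribed multiplicities `a`, `b`, `c`, `e` of the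
columns `(1,0)`, `(0,1)`, `(1,1)`, `(1,-1)`. -/
lemma exists_pair_wt {n : ℕ} (a b c e : ℕ) (hn : n = a + b + c + e) :
    ∃ u v : Fin n → ZMod 3, wt u = a + c + e ∧ wt v = b + c + e ∧
      wt (u + v) = a + b + c ∧ wt (u - v) = a + b + e := by
  let f : Fin n ≃ Fin a ⊕ Fin b ⊕ Fin c ⊕ Fin e :=
    (Fintype.equivFinOfCardEq (by simp; omega)).symm
  let U : Fin a ⊕ Fin b ⊕ Fin c ⊕ Fin e → ZMod 3 :=
    Sum.elim (fun _ => 1) (Sum.elim (fun _ => 0) (Sum.elim (fun _ => 1) fun _ => 1))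
  let V : Fin a ⊕ Fin b ⊕ Fin c ⊕ Fin e → ZMod 3 :=
    Sum.elim (fun _ => 0) (Sum.elim (fun _ => 1) (Sum.elim (fun _ => 1) fun _ => -1))
  have two_ne : (1 + 1 : ZMod 3) ≠ 0 := by decide
  refine ⟨U ∘ f, V ∘ f, ?_, ?_, ?_, ?_⟩
  · rw [wt_comp_equiv]; simp [U, add_assoc]
  · rw [wt_comp_equiv]; simp [V, add_assoc]
  · change wt ((U + V) ∘ f) = _
    rw [wt_comp_equiv]; simp [U, V, two_ne, add_assoc]
  · change wt ((U - V) ∘ f) = _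
    rw [wt_comp_equiv]; simp [U, V, two_ne, add_assoc]

lemma exists_lcd_of_pair {n d : ℕ} {u v : Fin n → ZMod 3} (hd : 0 < d) (hu : d ≤ wt u)
    (hv : wt v = d) (ha : d ≤ wt (u + v)) (hs : d ≤ wt (u - v)) (hdet : weightGram u v ≠ 0) :
    ∃ C : Submodule (ZMod 3) (Fin n → ZMod 3),
      Module.finrank (ZMod 3) C = 2 ∧ IsLCD C ∧ HasMinWeight C d := by
  have hle := le_wt_of_mem_pair hu hv.ge ha hs
  have hli : LinearIndependent (ZMod 3) ![u, v] := by
    rw [LinearIndependent.pair_iff]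
    intro x y hxy
    by_contra hne
    have := hle x y (by tauto)
    rw [hxy, wt_zero] at this
    omega
  refine ⟨Submodule.span (ZMod 3) {u, v}, ?_, (isLCD_span_pair_iff hli).2 hdet,
    ⟨v, Submodule.mem_span_of_mem (by simp), ?_, hv⟩, ?_⟩
  · rw [← Matrix.range_cons_cons_empty u v ![], finrank_span_eq_card hli, Fintype.card_fin]
  · rintro rfl
    rw [wt_zero] at hv
    omega
  · intro w hw hw0
    obtain ⟨x, y, rfl⟩ := Submodule.mem_span_pair.1 hw
    refine hle x y ?_
    by_contra! h
    simp [h.1, h.2] at hw0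

lemma exists_lcd_of_multiplicities {n : ℕ} (a b c e : ℕ) (hn : n = a + b + c + e)
    (hd : 0 < b + c + e) (hb : b ≤ a) (hc : c ≤ a) (he : e ≤ a)
    (hdet : ((a + c + e : ℕ) * (b + c + e : ℕ) - ((c : ZMod 3) - e) ^ 2 : ZMod 3) ≠ 0) :
    ∃ C : Submodule (ZMod 3) (Fin n → ZMod 3),
      Module.finrank (ZMod 3) C = 2 ∧ IsLCD C ∧ HasMinWeight C (b + c + e) := by
  obtain ⟨u, v, hu, hv, ha, hs⟩ := exists_pair_wt a b c e hn
  refine exists_lcd_of_pair (u := u) (v := v) hd (by omega) hv (by omega) (by omega) ?_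
  rw [weightGram, hu, hv, ha, hs]
  convert hdet using 3
  push_cast
  ring

lemma exists_lcd_d3n2 {n : ℕ} (hn : 2 ≤ n) :
    ∃ C : Submodule (ZMod 3) (Fin n → ZMod 3),
      Module.finrank (ZMod 3) C = 2 ∧ IsLCD C ∧ HasMinWeight C (d3n2 n) := by
  have key : ∀ m : ZMod 3, (m + 2 + (m + 1) + m) * (m + 2 + (m + 1) + m) -
      (m + 1 - m) ^ 2 ≠ 0 ∧ (m + 1 + m + m) * (m + 1 + m + m) - (m - m) ^ 2 ≠ 0 ∧
      (m + 2 + m + m) * (m + 1 + m + m) - (m - m) ^ 2 ≠ 0 ∧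
      (m + 2 + m + m) * (m + 2 + m + m) - (m - m) ^ 2 ≠ 0 := by decide
  obtain h | h | h | h : n % 4 = 0 ∨ n % 4 = 1 ∨ n % 4 = 2 ∨ n % 4 = 3 := by omega
  · obtain ⟨m, rfl⟩ : ∃ m, n = 4 * m + 4 := ⟨n / 4 - 1, by omega⟩
    have hd : d3n2 (4 * m + 4) = m + 2 + m + m := by rw [d3n2, if_neg] <;> omega
    rw [hd]
    refine exists_lcd_of_multiplicities (m + 2) (m + 2) m m ?_ ?_ ?_ ?_ ?_ ?_ <;> try omega
    exact_mod_cast (key m).2.2.2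
  · obtain ⟨m, rfl⟩ : ∃ m, n = 4 * m + 5 := ⟨n / 4 - 1, by omega⟩
    have hd : d3n2 (4 * m + 5) = m + 2 + (m + 1) + m := by rw [d3n2, if_pos] <;> omega
    rw [hd]
    refine exists_lcd_of_multiplicities (m + 2) (m + 2) (m + 1) m ?_ ?_ ?_ ?_ ?_ ?_ <;> try omega
    exact_mod_cast (key m).1
  · obtain ⟨m, rfl⟩ : ∃ m, n = 4 * m + 2 := ⟨n / 4, by omega⟩
    have hd : d3n2 (4 * m + 2) = m + 1 + m + m := by rw [d3n2, if_pos] <;> omega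
    rw [hd]
    refine exists_lcd_of_multiplicities (m + 1) (m + 1) m m ?_ ?_ ?_ ?_ ?_ ?_ <;> try omega
    exact_mod_cast (key m).2.1
  · obtain ⟨m, rfl⟩ : ∃ m, n = 4 * m + 3 := ⟨n / 4, by omega⟩
    have hd : d3n2 (4 * m + 3) = m + 1 + m + m := by rw [d3n2, if_neg] <;> omega
    rw [hd]
    refine exists_lcd_of_multiplicities (m + 2) (m + 1) m m ?_ ?_ ?_ ?_ ?_ ?_ <;> try omega
    exact_mod_cast (key m).2.2.1

lemma exists_pair_of_finrank_eq_two {n : ℕ} {C : Submodule (ZMod 3) (Fin n → ZMod 3)}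
    (hC : Module.finrank (ZMod 3) C = 2) :
    ∃ u v, LinearIndependent (ZMod 3) ![u, v] ∧ C = Submodule.span (ZMod 3) {u, v} := by
  let b := Module.finBasisOfFinrankEq (ZMod 3) C hC
  have hrange : C.subtype ∘ b = ![(b 0 : Fin n → ZMod 3), b 1] := by
    ext i : 1
    fin_cases i <;> rfl
  refine ⟨b 0, b 1, ?_, ?_⟩
  · rw [← hrange]
    exact b.linearIndependent.map' C.subtype C.ker_subtype
  · have := congrArg (Submodule.map C.subtype) b.span_eq
    rw [Submodule.map_span, ← Set.range_comp, hrange, Submodule.map_top,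
      Submodule.range_subtype, Matrix.range_cons_cons_empty] at this
    exact this.symm

lemma le_d3n2 {n d : ℕ} {u v : Fin n → ZMod 3} (hu : d ≤ wt u) (hv : d ≤ wt v)
    (ha : d ≤ wt (u + v)) (hs : d ≤ wt (u - v)) (hdet : weightGram u v ≠ 0) :
    d ≤ d3n2 n := by
  obtain ⟨k, hk, hsum⟩ := exists_sum_wt_eq u v
  by_contra! hlt
  apply hdet
  rw [weightGram]
  generalize wt u = p at *
  generalize wt v = q at *
  generalize wt (u + v) = r at *
  generalize wt (u - v) = s at *
  have h3 : (3 : ZMod 3) = 0 := by decide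
  obtain ⟨m, hm⟩ : ∃ m, n = 4 * m + n % 4 := ⟨n / 4, by omega⟩
  rw [d3n2] at hlt
  split_ifs at hlt with h
  · omega
  · obtain h | h : n % 4 = 0 ∨ n % 4 = 3 := by omega
    · obtain ⟨rfl, rfl, rfl, rfl⟩ : p = 3 * m ∧ q = 3 * m ∧ r = 3 * m ∧ s = 3 * m := by omega
      simp [h3]
    · have : p + q + r + s = 12 * m + 9 := by omega
      have hp : p = 3 * m + 2 ∨ p = 3 * m + 3 := by omega
      have hq : q = 3 * m + 2 ∨ q = 3 * m + 3 := by omega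
      have hr : r = 3 * m + 2 ∨ r = 3 * m + 3 := by omega
      have hs : s = 3 * m + 2 ∨ s = 3 * m + 3 := by omega
      rcases hp with rfl | rfl <;> rcases hq with rfl | rfl <;> rcases hr with rfl | rfl <;>
        rcases hs with rfl | rfl <;> first | omega | (push_cast; simp only [h3, zero_mul]; decide)

/-- Determination of the largest minimum weight `d₃(n,2)` among ternary LCD `[n,2]`
codes, for every `n ≥ 2`. -/
theorem d3_n_2 (n : ℕ) (hn : 2 ≤ n) :
    (∃ C : Submodule (ZMod 3) (Fin n → ZMod 3),
      Module.finrank (ZMod 3) C = 2 ∧ IsLCD C ∧ HasMinWeight C (d3n2 n)) ∧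
    ∀ (C : Submodule (ZMod 3) (Fin n → ZMod 3)) (d : ℕ),
      Module.finrank (ZMod 3) C = 2 → IsLCD C → HasMinWeight C d → d ≤ d3n2 n := by
  refine ⟨exists_lcd_d3n2 hn, fun C d hC hLCD hmin => ?_⟩
  obtain ⟨u, v, hli, rfl⟩ := exists_pair_of_finrank_eq_two hC
  have hle (x y : ZMod 3) (hxy : x ≠ 0 ∨ y ≠ 0) : d ≤ wt (x • u + y • v) := by
    refine hmin.2 _ (Submodule.mem_span_pair.2 ⟨x, y, rfl⟩) fun h0 => ?_
    obtain ⟨rfl, rfl⟩ := LinearIndependent.pair_iff.1 hli x y h0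
    simp at hxy
  refine le_d3n2 ?_ ?_ ?_ ?_ ((isLCD_span_pair_iff hli).1 hLCD)
  · simpa using hle 1 0 (by simp)
  · simpa using hle 0 1 (by simp)
  · simpa using hle 1 1 (by simp)
  · simpa [sub_eq_add_neg] using hle 1 (-1) (by simp)
end

section
/- For every integer n ≥ 3, the largest minimum weight d₃(n,3) among all ternary LCD [n,3] codes equals ⌊9n/13⌋ if n ≡ 4, 7, or 10 (mod 13), and equals ⌊9n/13⌋ − 1 if n ≡ 0,1,2,3,5,6,8,9,11, or 12 (mod 13). -/
open Matrix Finset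

/-- The claimed value of `d₃(n,3)`. -/
def d3n3 (n : ℕ) : ℕ :=
  if n % 13 = 4 ∨ n % 13 = 7 ∨ n % 13 = 10 then 9 * n / 13 else 9 * n / 13 - 1

section UpperBound

/-- The squared norm of a ternary vector is its weight modulo `3`. -/
lemma dotProduct_self_eq_wt {n : ℕ} (u : Fin n → ZMod 3) : u ⬝ᵥ u = (wt u : ZMod 3) := by
  have sq_eq : ∀ a : ZMod 3, a * a = if a ≠ 0 then 1 else 0 := by decide
  simp only [dotProduct, sq_eq, wt, Finset.sum_boole]

lemma card_dotProduct_ne_zero_le :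
    ∀ a : Fin 3 → ZMod 3, #{x : Fin 3 → ZMod 3 | x ⬝ᵥ a ≠ 0} ≤ 18 := by
  decide

/-- Plotkin-type bound: each coordinate vanishes on at least nine of the `27` combinations. -/
lemma sum_wt_vecMul_le {n : ℕ} (G : Matrix (Fin 3) (Fin n) (ZMod 3)) :
    ∑ x : Fin 3 → ZMod 3, wt (x ᵥ* G) ≤ 18 * n := by
  simp only [wt, Finset.card_filter]
  rw [Finset.sum_comm]
  calc ∑ j : Fin n, ∑ x : Fin 3 → ZMod 3, (if (x ᵥ* G) j ≠ 0 then 1 else 0)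
      ≤ ∑ _j : Fin n, 18 := Finset.sum_le_sum fun j _ => by
        rw [← Finset.card_filter]
        exact card_dotProduct_ne_zero_le fun i => G i j
    _ = 18 * n := by simp [mul_comm]

/-- The values of a nondegenerate diagonal ternary quadratic form are spread out: their residues
relative to a fixed `e` sum to at least `20` over the nonzero vectors. -/
lemma le_sum_val_diagonal_sub :
    ∀ a : Fin 3 → ZMod 3, (∀ i, a i ≠ 0) → ∀ e : ZMod 3,
      20 ≤ ∑ x ∈ (univ : Finset (Fin 3 → ZMod 3)).erase 0, (∑ i, a i * (x i * x i) - e).val := by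
  decide

lemma add_val_sub_le {d w : ℕ} (h : d ≤ w) : d + ((w : ZMod 3) - d).val ≤ w := by
  rw [← Nat.cast_sub h, ZMod.val_natCast]
  have := Nat.mod_le (w - d) 3
  omega

/-- A matrix with orthogonal, non-isotropic rows generates a code of small minimum weight. -/
lemma le_of_orthogonal_rows {n d : ℕ} (G : Matrix (Fin 3) (Fin n) (ZMod 3))
    (horth : ∀ i j, i ≠ j → G i ⬝ᵥ G j = 0) (hself : ∀ i, G i ⬝ᵥ G i ≠ 0)
    (hd : ∀ x : Fin 3 → ZMod 3, x ≠ 0 → d ≤ wt (x ᵥ* G)) : 13 * d + 10 ≤ 9 * n := by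
  have hQ (x : Fin 3 → ZMod 3) :
      (wt (x ᵥ* G) : ZMod 3) = ∑ i, G i ⬝ᵥ G i * (x i * x i) := by
    rw [← dotProduct_self_eq_wt, Matrix.vecMul_eq_sum]
    simp only [sum_dotProduct, dotProduct_sum, smul_dotProduct, dotProduct_smul, smul_eq_mul]
    refine Finset.sum_congr rfl fun i _ => ?_
    rw [Finset.sum_eq_single i (fun j _ hj => by simp [horth j i hj]) (by simp)]
    ring
  have hlow : 26 * d + 20 ≤ ∑ x : Fin 3 → ZMod 3, wt (x ᵥ* G) := by
    calc 26 * d + 20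
        ≤ ∑ x ∈ (univ : Finset (Fin 3 → ZMod 3)).erase 0,
            (d + (∑ i, G i ⬝ᵥ G i * (x i * x i) - (d : ZMod 3)).val) := by
          have := le_sum_val_diagonal_sub (fun i => G i ⬝ᵥ G i) hself d
          rw [Finset.sum_add_distrib]
          simpa using this
      _ ≤ ∑ x ∈ (univ : Finset (Fin 3 → ZMod 3)).erase 0, wt (x ᵥ* G) :=
          Finset.sum_le_sum fun x hx => by
            rw [← hQ]
            exact add_val_sub_le (hd x (Finset.ne_of_mem_erase hx))
      _ ≤ _ := Finset.sum_le_sum_of_subset (Finset.subset_univ _)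
  have := sum_wt_vecMul_le G
  omega

/-- Every LCD code of dimension `3` over `𝔽₃` has a basis of orthogonal, non-isotropic vectors. -/
lemma IsLCD.exists_orthogonal_basis {n : ℕ} {C : Submodule (ZMod 3) (Fin n → ZMod 3)}
    (hC : IsLCD C) (hdim : Module.finrank (ZMod 3) C = 3) :
    ∃ v : Module.Basis (Fin 3) (ZMod 3) C,
      (∀ i j, i ≠ j → (v i : Fin n → ZMod 3) ⬝ᵥ v j = 0) ∧
        ∀ i, (v i : Fin n → ZMod 3) ⬝ᵥ v i ≠ 0 := by
  let B : LinearMap.BilinForm (ZMod 3) C :=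
    (dotProductBilin (ZMod 3) (ZMod 3)).domRestrict₁₂ C C
  have hB (x y : C) : B x y = (x : Fin n → ZMod 3) ⬝ᵥ y := rfl
  have hsymm : LinearMap.IsSymm B :=
    ⟨fun x y => dotProduct_comm (x : Fin n → ZMod 3) (y : Fin n → ZMod 3)⟩
  have hsep : LinearMap.SeparatingLeft B := fun x hx => by
    have hmem : (x : Fin n → ZMod 3) ∈ C ⊓ dualCode C := ⟨x.2, fun y hy => hx ⟨y, hy⟩⟩
    rw [hC] at hmem
    exact Subtype.ext hmem
  have : Invertible (2 : ZMod 3) := ⟨2, by decide, by decide⟩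
  obtain ⟨v, hv⟩ := LinearMap.BilinForm.exists_orthogonal_basis hsymm
  have hv' := hv.not_isOrtho_basis_self_of_separatingLeft hsep
  refine ⟨v.reindex (finCongr hdim), fun i j hij => ?_, fun i => ?_⟩
  · simpa [hB] using
      hv (i := (finCongr hdim).symm i) (j := (finCongr hdim).symm j) (by simpa using hij)
  · simpa [hB] using hv' ((finCongr hdim).symm i)

lemma IsLCD.minWeight_le {n d : ℕ} {C : Submodule (ZMod 3) (Fin n → ZMod 3)} (hC : IsLCD C)
    (hdim : Module.finrank (ZMod 3) C = 3) (hd : ∀ x ∈ C, x ≠ 0 → d ≤ wt x) :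
    13 * d + 10 ≤ 9 * n := by
  obtain ⟨v, horth, hself⟩ := hC.exists_orthogonal_basis hdim
  refine le_of_orthogonal_rows (Matrix.of fun i => (v i : Fin n → ZMod 3)) horth hself
    fun x hx => ?_
  have hcoe : x ᵥ* (Matrix.of fun i => (v i : Fin n → ZMod 3)) = v.equivFun.symm x := by
    simp only [Matrix.vecMul_eq_sum, Module.Basis.equivFun_symm_apply, Submodule.coe_sum,
      Submodule.coe_smul]
    rfl
  rw [hcoe]
  exact hd _ (Subtype.coe_prop _) fun h => hx (v.equivFun.symm.map_eq_zero_iff.mp (Subtype.ext h))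

end UpperBound

section Construction

/-- An infinite sequence of columns: the three unit vectors, followed by the points of `PG(2, 3)`
repeated with period `13`. Its prefixes generate optimal LCD codes. -/
def lcdCol (j : ℕ) : Fin 3 → ZMod 3 :=
  if j = 0 then ![1, 0, 0] else if j = 1 then ![0, 1, 0] else if j = 2 then ![0, 0, 1] else
    ![![0, 0, 1], ![1, 2, 0], ![1, 2, 1], ![1, 1, 1], ![0, 1, 1], ![1, 0, 1], ![1, 1, 0],
      ![0, 1, 2], ![1, 2, 2], ![1, 0, 2], ![0, 1, 0], ![1, 0, 0], ![1, 1, 2]] (Fin.ofNat 13 j)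

lemma lcdCol_add_thirteen {j : ℕ} (hj : 3 ≤ j) : lcdCol (j + 13) = lcdCol j := by
  have : Fin.ofNat 13 (j + 13) = Fin.ofNat 13 j := by ext; simp
  simp only [lcdCol, this, show j ≠ 0 by omega, show j ≠ 1 by omega, show j ≠ 2 by omega,
    show j + 13 ≠ 0 by omega, show j + 13 ≠ 1 by omega, show j + 13 ≠ 2 by omega, if_false]

lemma sum_range_add_thirteen {M : Type*} [AddCommMonoid M] (f : (Fin 3 → ZMod 3) → M) {n : ℕ}
    (hn : 3 ≤ n) :
    ∑ j ∈ range (n + 13), f (lcdCol j) =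
      ∑ j ∈ range n, f (lcdCol j) + ∑ j ∈ range 13, f (lcdCol (j + 3)) := by
  induction n, hn using Nat.le_induction with
  | base => simpa only [add_comm 3] using Finset.sum_range_add (fun j => f (lcdCol j)) 3 13
  | succ n hn ih =>
    rw [add_right_comm, Finset.sum_range_succ, ih, lcdCol_add_thirteen hn,
      Finset.sum_range_succ _ n, add_right_comm]

lemma simplex_weight : ∀ x : Fin 3 → ZMod 3, x ≠ 0 →
    ∑ j ∈ range 13, (if x ⬝ᵥ lcdCol (j + 3) ≠ 0 then 1 else 0) = 9 := by
  decide

lemma simplex_gram : ∀ x : Fin 3 → ZMod 3,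
    ∑ j ∈ range 13, (x ⬝ᵥ lcdCol (j + 3)) • lcdCol (j + 3) = 0 := by
  decide

lemma le_weight_prefix {x : Fin 3 → ZMod 3} (hx : x ≠ 0) (n : ℕ) (hn : 3 ≤ n) :
    (9 * n - 10) / 13 ≤ ∑ j ∈ range n, (if x ⬝ᵥ lcdCol j ≠ 0 then 1 else 0) := by
  induction n using Nat.strong_induction_on with
  | _ n ih =>
    rcases lt_or_ge n 16 with h | h
    · have base : ∀ n < 16, 3 ≤ n → ∀ x : Fin 3 → ZMod 3, x ≠ 0 →
          (9 * n - 10) / 13 ≤ ∑ j ∈ range n, (if x ⬝ᵥ lcdCol j ≠ 0 then 1 else 0) := by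
        decide
      exact base n h hn x hx
    · obtain ⟨m, rfl⟩ := Nat.exists_eq_add_of_le' (show 13 ≤ n by omega)
      rw [sum_range_add_thirteen (fun c => if x ⬝ᵥ c ≠ 0 then 1 else 0) (by omega),
        simplex_weight x hx]
      have := ih m (by omega) (by omega)
      omega

lemma eq_zero_of_gram_prefix {x : Fin 3 → ZMod 3} (n : ℕ) (hn : 3 ≤ n)
    (hx : ∑ j ∈ range n, (x ⬝ᵥ lcdCol j) • lcdCol j = 0) : x = 0 := by
  induction n using Nat.strong_induction_on with
  | _ n ih =>
    rcases lt_or_ge n 16 with h | h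
    · have base : ∀ n < 16, 3 ≤ n → ∀ x : Fin 3 → ZMod 3,
          ∑ j ∈ range n, (x ⬝ᵥ lcdCol j) • lcdCol j = 0 → x = 0 := by
        decide
      exact base n h hn x hx
    · obtain ⟨m, rfl⟩ := Nat.exists_eq_add_of_le' (show 13 ≤ n by omega)
      rw [sum_range_add_thirteen (fun c => (x ⬝ᵥ c) • c) (by omega), simplex_gram, add_zero] at hx
      exact ih m (by omega) (by omega) hx

/-- For every `n ≥ 3` some ternary LCD `[n, 3]` code has all nonzero weights at least
`⌊(9n - 10) / 13⌋`. -/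
lemma exists_isLCD (n : ℕ) (hn : 3 ≤ n) :
    ∃ C : Submodule (ZMod 3) (Fin n → ZMod 3), Module.finrank (ZMod 3) C = 3 ∧ IsLCD C ∧
      ∀ u ∈ C, u ≠ 0 → (9 * n - 10) / 13 ≤ wt u := by
  let G : Matrix (Fin 3) (Fin n) (ZMod 3) := Matrix.of fun i j => lcdCol j i
  have hG (x : Fin 3 → ZMod 3) (j : Fin n) : G.vecMulLinear x j = x ⬝ᵥ lcdCol j := rfl
  have hgram (x : Fin 3 → ZMod 3)
      (h : ∀ y, ∑ j, G.vecMulLinear x j * G.vecMulLinear y j = 0) : x = 0 := by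
    refine eq_zero_of_gram_prefix n hn ?_
    rw [← Fin.sum_univ_eq_sum_range (fun j => (x ⬝ᵥ lcdCol j) • lcdCol j) n]
    ext i
    simpa [hG] using h (Pi.single i 1)
  have hinj : Function.Injective G.vecMulLinear := by
    rw [injective_iff_map_eq_zero]
    exact fun x hx => hgram x fun y => by simp [hx]
  refine ⟨LinearMap.range G.vecMulLinear, ?_, ?_, ?_⟩
  · rw [LinearMap.finrank_range_of_inj hinj, Module.finrank_fin_fun]
  · rw [IsLCD, Submodule.eq_bot_iff]
    rintro _ ⟨⟨x, rfl⟩, hx⟩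
    rw [hgram x fun y => hx _ ⟨y, rfl⟩, map_zero]
  · rintro _ ⟨x, rfl⟩ hne
    have hx : x ≠ 0 := by rintro rfl; simp at hne
    rw [wt, Finset.card_filter]
    simp only [hG]
    rw [Fin.sum_univ_eq_sum_range (fun j => if x ⬝ᵥ lcdCol j ≠ 0 then 1 else 0) n]
    exact le_weight_prefix hx n hn

end Construction

lemma d3n3_eq {n : ℕ} (hn : 3 ≤ n) : d3n3 n = (9 * n - 10) / 13 := by
  obtain ⟨q, r, hr, rfl⟩ : ∃ q r, r < 13 ∧ n = 13 * q + r :=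
    ⟨n / 13, n % 13, Nat.mod_lt _ (by norm_num), (Nat.div_add_mod n 13).symm⟩
  unfold d3n3
  interval_cases r <;> split_ifs <;> omega

/-- Determination of the largest minimum weight `d₃(n,3)` among ternary LCD `[n,3]`
codes, for every `n ≥ 3`. -/
theorem d3_n_3 (n : ℕ) (hn : 3 ≤ n) :
    (∃ C : Submodule (ZMod 3) (Fin n → ZMod 3),
      Module.finrank (ZMod 3) C = 3 ∧ IsLCD C ∧ HasMinWeight C (d3n3 n)) ∧
    ∀ (C : Submodule (ZMod 3) (Fin n → ZMod 3)) (d : ℕ),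
      Module.finrank (ZMod 3) C = 3 → IsLCD C → HasMinWeight C d → d ≤ d3n3 n := by
  have hle : ∀ (C : Submodule (ZMod 3) (Fin n → ZMod 3)) (d : ℕ),
      Module.finrank (ZMod 3) C = 3 → IsLCD C → HasMinWeight C d → d ≤ d3n3 n := by
    intro C d hdim hC hd
    have := hC.minWeight_le hdim hd.2
    rw [d3n3_eq hn]
    omega
  refine ⟨?_, hle⟩
  obtain ⟨C, hdim, hC, hwt⟩ := exists_isLCD n hn
  have hbot : C ≠ ⊥ := by rintro rfl; simp at hdim
  obtain ⟨u, ⟨huC, hu⟩, hmin⟩ := exists_minimalFor_of_wellFoundedLT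
    (fun u => u ∈ C ∧ u ≠ 0) wt (C.ne_bot_iff.mp hbot)
  have hd : HasMinWeight C (wt u) :=
    ⟨⟨u, huC, hu, rfl⟩, fun x hx hx0 => (le_total (wt u) (wt x)).elim id (hmin ⟨hx, hx0⟩)⟩
  have heq : wt u = d3n3 n :=
    (hle C _ hdim hC hd).antisymm (by rw [d3n3_eq hn]; exact hwt u huC hu)
  exact ⟨C, hdim, hC, heq ▸ hd⟩
end

section
/- (i) For every integer s ≥ 2, there are exactly 7 equivalence classes of binary LCD [7s+1, 3, 4s−1] codes with dual distance d⊥ ≥ 2 (here 4s−1 = d₂(7s+1,3), so these are optimal). (ii) For t ∈ {4,6} and every integer s ≥ 1, there are exactly 5 equivalence classes of binary LCD [7s+t, 3, d₂(7s+t,3)] codes with dual distance d⊥ ≥ 2, where d₂(7s+4,3) = 4s+1 and d₂(7s+6,3) = 4s+2. -/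
open Matrix Finset

/-- The vector of `𝔽₂³` whose coordinates are the binary digits of `k`. -/
def bitVec (k : Fin 8) : Fin 3 → ZMod 2 := fun i => if k.val.testBit i then 1 else 0

/-- The standard inner product of the vectors of binary digits of `a` and `k`. -/
def bitDot (a k : Fin 8) : Bool :=
  (a.val.testBit 0 && k.val.testBit 0) ^^ (a.val.testBit 1 && k.val.testBit 1) ^^
    (a.val.testBit 2 && k.val.testBit 2)

/-- The linear map of `𝔽₂³` with columns `p`, `q`, `r`, in terms of binary digits. -/
def bitLin (p q r k : Fin 8) : Fin 8 :=
  (if k.val.testBit 0 then p else 0) ^^^ (if k.val.testBit 1 then q else 0) ^^^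
    (if k.val.testBit 2 then r else 0)

lemma bitVec_bijective : Function.Bijective bitVec := by decide +kernel

@[simp] lemma bitVec_zero : bitVec 0 = 0 := by decide

lemma bitVec_dotProduct (a k : Fin 8) :
    bitVec a ⬝ᵥ bitVec k = if bitDot a k then 1 else 0 := by
  revert a k; decide +kernel

lemma exists_bitDot {k : Fin 8} (hk : k ≠ 0) : ∃ a, bitDot a k = true := by
  revert k; decide

lemma bitVec_xor (a b : Fin 8) : bitVec (a ^^^ b) = bitVec a + bitVec b := by
  revert a b; decide +kernel

lemma bitVec_bitLin (p q r k : Fin 8) (i : Fin 3) :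
    bitVec (bitLin p q r k) i =
      bitVec p i * bitVec k 0 + bitVec q i * bitVec k 1 + bitVec r i * bitVec k 2 := by
  have h : ∀ (c : Bool) (a : Fin 8),
      bitVec (if c then a else 0) i = bitVec a i * if c then 1 else 0 := by
    rintro (_ | _) a <;> simp
  simp only [bitLin, bitVec_xor, Pi.add_apply, h]
  rfl

lemma bitVec_dotProduct_bitLin (p q r a k : Fin 8) :
    bitVec a ⬝ᵥ bitVec (bitLin p q r k) =
      ![bitVec a ⬝ᵥ bitVec p, bitVec a ⬝ᵥ bitVec q, bitVec a ⬝ᵥ bitVec r] ⬝ᵥ bitVec k := by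
  simp only [dotProduct, Fin.sum_univ_three, bitVec_bitLin, Matrix.cons_val]
  ring

/-- Linear independence of `p`, `q`, `r`, in terms of binary digits. -/
def BitIndep (p q r : Fin 8) : Prop :=
  p ≠ 0 ∧ q ≠ 0 ∧ q ≠ p ∧ r ≠ 0 ∧ r ≠ p ∧ r ≠ q ∧ r ≠ p ^^^ q

instance (p q r : Fin 8) : Decidable (BitIndep p q r) := by unfold BitIndep; infer_instance

lemma BitIndep.bitLin_bijective {p q r : Fin 8} (h : BitIndep p q r) :
    Function.Bijective (bitLin p q r) := by
  refine Finite.injective_iff_bijective.1 ?_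
  revert p q r; decide +kernel

lemma bitLin_basis (p q r : Fin 8) : bitLin p q r 1 = p ∧ bitLin p q r 2 = q ∧
    bitLin p q r 3 = p ^^^ q ∧ bitLin p q r 4 = r := by
  revert p q r; decide +kernel

lemma bitLin_zero (p q r : Fin 8) : bitLin p q r 0 = 0 := by simp [bitLin]

lemma bitIndep_of_forall_exists {p q r : Fin 8}
    (h : ∀ a ≠ 0, ∃ k, bitDot a (bitLin p q r k) = true) : BitIndep p q r := by
  revert p q r; decide +kernel

/-- The encoder of the code whose generator matrix has columns `bitVec (g j)`. -/
def encode {n : ℕ} (g : Fin n → Fin 8) : (Fin 3 → ZMod 2) →ₗ[ZMod 2] (Fin n → ZMod 2) where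
  toFun x j := x ⬝ᵥ bitVec (g j)
  map_add' x y := by ext j; simp [add_dotProduct]
  map_smul' c x := by ext j; simp [smul_dotProduct]

lemma encode_apply {n : ℕ} (g : Fin n → Fin 8) (x : Fin 3 → ZMod 2) (j : Fin n) :
    encode g x j = x ⬝ᵥ bitVec (g j) := rfl

/-- The multiplicity of the column `bitVec k`. -/
def mult {n : ℕ} (g : Fin n → Fin 8) (k : Fin 8) : ℕ := #{j | g j = k}

/-- The weight of the codeword belonging to `a`, for column multiplicities `m`. -/
def colWeight (m : Fin 8 → ℕ) (a : Fin 8) : ℕ := ∑ k, if bitDot a k then m k else 0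

/-- The inner product of the codewords belonging to `a` and `b`, for column multiplicities `m`. -/
def colGram (m : Fin 8 → ℕ) (a b : Fin 8) : ℕ :=
  ∑ k, if bitDot a k && bitDot b k then m k else 0

/-- The Gram form of the column multiplicities `m` is nondegenerate modulo 2. -/
def GramNondeg (m : Fin 8 → ℕ) : Prop := ∀ a ≠ 0, ∃ b, colGram m a b % 2 = 1

instance (m : Fin 8 → ℕ) : Decidable (GramNondeg m) := by unfold GramNondeg; infer_instance

section Encode

variable {n : ℕ} {g : Fin n → Fin 8}

lemma sum_mult (g : Fin n → Fin 8) : ∑ k, mult g k = n := by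
  simpa [mult] using (Finset.card_eq_sum_card_fiberwise (f := g) (s := univ) (t := univ)
    (by simp)).symm

lemma wt_encode (g : Fin n → Fin 8) (a : Fin 8) :
    wt (encode g (bitVec a)) = colWeight (mult g) a := by
  have h : ∀ j, encode g (bitVec a) j ≠ 0 ↔ bitDot a (g j) = true := fun j => by
    rw [encode_apply, bitVec_dotProduct]; cases bitDot a (g j) <;> simp
  simp only [wt, h, colWeight, mult]
  rw [Finset.card_eq_sum_card_fiberwise (f := g) (t := univ) (by simp)]
  refine Finset.sum_congr rfl fun k _ => ?_
  split_ifs with hk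
  · congr 1; ext j; simp; rintro rfl; exact hk
  · simp only [Finset.card_eq_zero, Finset.filter_eq_empty_iff]; aesop

lemma sum_encode_mul_encode (g : Fin n → Fin 8) (a b : Fin 8) :
    ∑ j, encode g (bitVec a) j * encode g (bitVec b) j = (colGram (mult g) a b : ZMod 2) := by
  have h : ∀ j, encode g (bitVec a) j * encode g (bitVec b) j =
      if bitDot a (g j) && bitDot b (g j) then 1 else 0 := fun j => by
    rw [encode_apply, encode_apply, bitVec_dotProduct, bitVec_dotProduct]
    cases bitDot a (g j) <;> cases bitDot b (g j) <;> simp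
  simp only [h, colGram, mult, Nat.cast_sum]
  rw [← Finset.sum_fiberwise univ g]
  refine Finset.sum_congr rfl fun k _ => ?_
  rw [Finset.sum_congr rfl (g := fun _ => if bitDot a k && bitDot b k then (1 : ZMod 2) else 0)
    (by intro j hj; rw [(Finset.mem_filter.1 hj).2])]
  split_ifs <;> simp

lemma forall_mem_range_encode {p : (Fin n → ZMod 2) → Prop} :
    (∀ x ∈ LinearMap.range (encode g), p x) ↔ ∀ a, p (encode g (bitVec a)) := by
  simp [bitVec_bijective.2.forall]

lemma GramNondeg.encode_injective (h : GramNondeg (mult g)) :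
    Function.Injective (encode g) := by
  rw [← LinearMap.ker_eq_bot, LinearMap.ker_eq_bot', bitVec_bijective.2.forall]
  intro a ha
  by_contra hne
  obtain ⟨b, hb⟩ := h a (by rintro rfl; simp at hne)
  have := sum_encode_mul_encode g a b
  rw [ha, ← ZMod.natCast_mod, hb] at this
  simp at this

lemma encode_eq_zero_iff (hg : Function.Injective (encode g)) (a : Fin 8) :
    encode g (bitVec a) = 0 ↔ a = 0 := by
  rw [map_eq_zero_iff _ hg]
  exact ⟨fun h => bitVec_bijective.1 (h.trans bitVec_zero.symm), fun h => h ▸ bitVec_zero⟩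

lemma finrank_range_encode (hg : Function.Injective (encode g)) :
    Module.finrank (ZMod 2) (LinearMap.range (encode g)) = 3 := by
  simp [LinearMap.finrank_range_of_inj hg]

lemma isLCD_range_encode_iff (hg : Function.Injective (encode g)) :
    IsLCD (LinearMap.range (encode g)) ↔ GramNondeg (mult g) := by
  have key : ∀ a, encode g (bitVec a) ∈ dualCode (LinearMap.range (encode g)) ↔
      ∀ b, colGram (mult g) a b % 2 = 0 := fun a => by
    change (∀ y ∈ LinearMap.range (encode g), _) ↔ _
    rw [forall_mem_range_encode]
    refine forall_congr' fun b => ?_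
    rw [sum_encode_mul_encode, ZMod.natCast_eq_zero_iff, Nat.dvd_iff_mod_eq_zero]
  rw [IsLCD, Submodule.eq_bot_iff]
  simp only [Submodule.mem_inf, and_imp]
  rw [forall_mem_range_encode]
  refine forall_congr' fun a => ?_
  rw [key, encode_eq_zero_iff hg, ← not_imp_not]
  simp only [not_forall, Nat.mod_two_ne_zero]

lemma hasMinWeight_range_encode_iff (hg : Function.Injective (encode g)) (d : ℕ) :
    HasMinWeight (LinearMap.range (encode g)) d ↔
      (∃ a ≠ 0, colWeight (mult g) a = d) ∧ ∀ a ≠ 0, d ≤ colWeight (mult g) a := by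
  rw [HasMinWeight, forall_mem_range_encode]
  simp [bitVec_bijective.2.exists, wt_encode, encode_eq_zero_iff hg]

lemma dualDistGe_two_range_encode_iff :
    DualDistGe (LinearMap.range (encode g)) 2 ↔ mult g 0 = 0 := by
  have hmem : ∀ x, x ∈ dualCode (LinearMap.range (encode g)) ↔
      ∀ a, ∑ j, x j * encode g (bitVec a) j = 0 := fun x =>
    forall_mem_range_encode (p := fun y => ∑ j, x j * y j = 0)
  simp only [DualDistGe, hmem, mult, Finset.card_eq_zero, Finset.filter_eq_empty_iff,
    Finset.mem_univ, forall_const]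
  constructor
  · intro h j hj
    have := h (Pi.single j 1) (fun a => by simp [Pi.single_apply, encode_apply, hj])
      (by simp)
    rw [wt, Finset.card_eq_one.2 ⟨j, by ext i; simp [Pi.single_apply]⟩] at this
    lia
  · intro h x hx hx0
    by_contra! hlt
    obtain ⟨j, hj⟩ := Function.ne_iff.1 hx0
    have hj1 : x j = 1 := (Fin.eq_one_of_ne_zero (x j) hj)
    have huniq : ∀ i, i ≠ j → x i = 0 := by
      intro i hij
      by_contra hi
      have := (Finset.card_le_one.1 (Nat.lt_succ_iff.1 hlt)) i (by simpa using hi) j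
        (by simpa using hj)
      exact hij this
    obtain ⟨a, ha⟩ := exists_bitDot (h (x := j))
    have := hx a
    rw [Finset.sum_eq_single j (fun i _ hi => by simp [huniq i hi]) (by simp), hj1,
      encode_apply, bitVec_dotProduct, ha] at this
    simp at this

lemma exists_range_encode_eq {C : Submodule (ZMod 2) (Fin n → ZMod 2)}
    (hC : Module.finrank (ZMod 2) C = 3) :
    ∃ g : Fin n → Fin 8, Function.Injective (encode g) ∧ LinearMap.range (encode g) = C := by
  let b := Module.finBasisOfFinrankEq (ZMod 2) C hC
  let f : (Fin 3 → ZMod 2) →ₗ[ZMod 2] (Fin n → ZMod 2) :=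
    C.subtype ∘ₗ b.equivFun.symm.toLinearMap
  choose g hg using fun j => bitVec_bijective.2 fun i => (b i : Fin n → ZMod 2) j
  have hf : encode g = f := by
    ext i j
    simp [encode_apply, hg, f, Pi.single_apply]
  refine ⟨g, ?_, ?_⟩
  · rw [hf]
    exact C.injective_subtype.comp b.equivFun.symm.injective
  · rw [hf, LinearMap.range_comp_of_range_eq_top _ (LinearEquiv.range _), Submodule.range_subtype]

end Encode

lemma codeEquiv_iff_exists_perm {n : ℕ} {C₁ C₂ : Submodule (ZMod 2) (Fin n → ZMod 2)} :
    codeEquiv C₁ C₂ ↔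
      ∃ σ : Equiv.Perm (Fin n), C₂ = C₁.map (LinearMap.funLeft (ZMod 2) (ZMod 2) σ) := by
  have key : ∀ (σ : Equiv.Perm (Fin n)) (P : Matrix (Fin n) (Fin n) (ZMod 2)),
      (∀ i j, P i j = if σ i = j then 1 else 0) →
        Matrix.vecMulLinear P = LinearMap.funLeft (ZMod 2) (ZMod 2) σ.symm := by
    intro σ P hP
    refine LinearMap.ext fun x => funext fun j => ?_
    simp [Matrix.vecMul, dotProduct, hP, LinearMap.funLeft_apply,
      ← Equiv.eq_symm_apply]
  constructor
  · rintro ⟨P, ⟨σ, c, hc, hP⟩, rfl⟩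
    refine ⟨σ.symm, ?_⟩
    rw [key σ P fun i j => by rw [hP, show c i = 1 from Fin.eq_one_of_ne_zero (c i) (hc i)]]
  · rintro ⟨σ, rfl⟩
    refine ⟨Matrix.of fun i j => if σ.symm i = j then 1 else 0,
      ⟨σ.symm, fun _ => 1, by simp, by simp⟩, ?_⟩
    rw [key σ.symm _ (by simp), Equiv.symm_symm]

lemma map_funLeft_range_encode {n : ℕ} (g : Fin n → Fin 8) (σ : Equiv.Perm (Fin n)) :
    (LinearMap.range (encode g)).map (LinearMap.funLeft (ZMod 2) (ZMod 2) σ) =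
      LinearMap.range (encode (g ∘ σ)) := by
  rw [← LinearMap.range_comp]
  rfl

lemma exists_perm_of_mult_eq {n : ℕ} {g h : Fin n → Fin 8} (H : mult g = mult h) :
    ∃ σ : Equiv.Perm (Fin n), ∀ j, g (σ j) = h j := by
  have e : ∀ k, {j // h j = k} ≃ {j // g j = k} := fun k => Fintype.equivOfCardEq <| by
    rw [Fintype.card_subtype, Fintype.card_subtype]
    exact (congrFun H k).symm
  exact ⟨Equiv.ofFiberEquiv e, fun j => Equiv.ofFiberEquiv_map e j⟩

lemma exists_mult_eq {n : ℕ} {m : Fin 8 → ℕ} (hm : ∑ k, m k = n) :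
    ∃ g : Fin n → Fin 8, mult g = m := by
  let e : Fin n ≃ Σ k, Fin (m k) := Fintype.equivOfCardEq (by simp [hm])
  refine ⟨fun j => (e j).1, funext fun k => ?_⟩
  rw [mult, ← Fintype.card_subtype,
    Fintype.card_congr ((e.subtypeEquiv (q := fun z => z.1 = k) fun _ => Iff.rfl).trans
      (Equiv.sigmaSubtype k))]
  simp

/-- The nonzero columns with multiplicities `x` become those with multiplicities `y` under an
invertible linear map. -/
def ColCongr (x y : Fin 8 → ℕ) : Prop :=
  ∃ p, x p = y 1 ∧ ∃ q, x q = y 2 ∧ x (p ^^^ q) = y 3 ∧ ∃ r, x r = y 4 ∧ x (p ^^^ r) = y 5 ∧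
    x (q ^^^ r) = y 6 ∧ x (p ^^^ q ^^^ r) = y 7 ∧ BitIndep p q r

instance (x y : Fin 8 → ℕ) : Decidable (ColCongr x y) := by unfold ColCongr; infer_instance

lemma colCongr_iff {x y : Fin 8 → ℕ} :
    ColCongr x y ↔ ∃ p q r, BitIndep p q r ∧ ∀ k ≠ 0, x (bitLin p q r k) = y k := by
  have h : ∀ p q r, (∀ k ≠ 0, x (bitLin p q r k) = y k) ↔ x p = y 1 ∧ x q = y 2 ∧
      x (p ^^^ q) = y 3 ∧ x r = y 4 ∧ x (p ^^^ r) = y 5 ∧ x (q ^^^ r) = y 6 ∧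
      x (p ^^^ q ^^^ r) = y 7 := by
    intro p q r
    have h0 : ∀ a : Fin 8, 0 ^^^ a = a := by decide
    simp [Fin.forall_fin_succ, bitLin, Nat.testBit, h0]
  simp only [ColCongr, h]
  grind

lemma mult_comp_bijective {n : ℕ} (g : Fin n → Fin 8) {f : Fin 8 → Fin 8}
    (hf : Function.Bijective f) (k : Fin 8) : mult (f ∘ g) (f k) = mult g k := by
  simp [mult, hf.1.eq_iff]

lemma range_encode_bitLin_le {n : ℕ} (g : Fin n → Fin 8) (p q r : Fin 8) :
    LinearMap.range (encode (bitLin p q r ∘ g)) ≤ LinearMap.range (encode g) := by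
  intro x
  revert x
  rw [forall_mem_range_encode]
  intro a
  exact ⟨_, funext fun j => (bitVec_dotProduct_bitLin p q r a (g j)).symm⟩

/-- The columns `1`, `2`, `4` form a basis chosen greedily by decreasing multiplicity. -/
def GreedySorted (m : Fin 8 → ℕ) : Prop :=
  m 2 ≤ m 1 ∧ m 3 ≤ m 2 ∧ m 4 ≤ m 2 ∧ m 5 ≤ m 4 ∧ m 6 ≤ m 4 ∧ m 7 ≤ m 4

lemma GreedySorted.imp {m x : Fin 8 → ℕ} (hm : GreedySorted m)
    (h : ∀ {k l}, m k ≤ m l → x k ≤ x l) : GreedySorted x :=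
  ⟨h hm.1, h hm.2.1, h hm.2.2.1, h hm.2.2.2.1, h hm.2.2.2.2.1, h hm.2.2.2.2.2⟩

lemma exists_greedySorted (m : Fin 8 → ℕ) :
    ∃ p q r, BitIndep p q r ∧ GreedySorted (m ∘ bitLin p q r) := by
  have hmax : ∀ P : Fin 8 → Prop, (∃ k, P k) → ∃ k, P k ∧ ∀ l, P l → m l ≤ m k := by
    intro P ⟨k, hk⟩
    classical
    obtain ⟨l, hl, h⟩ := Finset.exists_max_image {k | P k} m ⟨k, by simpa using hk⟩
    exact ⟨l, by simpa using hl, fun j hj => h j (by simpa using hj)⟩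
  obtain ⟨p, hp, hpmax⟩ := hmax (· ≠ 0) ⟨1, by decide⟩
  obtain ⟨q, ⟨hq, hqp⟩, hqmax⟩ := hmax (fun k => k ≠ 0 ∧ k ≠ p) (by clear hpmax; revert p; decide)
  obtain ⟨r, ⟨hr, hrp, hrq, hrpq⟩, hrmax⟩ :=
    hmax (fun k => k ≠ 0 ∧ k ≠ p ∧ k ≠ q ∧ k ≠ p ^^^ q) (by
      clear hpmax hqmax; revert p q; decide)
  have hind : BitIndep p q r := ⟨hp, hq, hqp, hr, hrp, hrq, hrpq⟩
  obtain ⟨h1, h2, h3, h4⟩ := bitLin_basis p q r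
  have hne : ∀ k l, k ≠ l → bitLin p q r k ≠ bitLin p q r l := fun k l => hind.bitLin_bijective.1.ne
  have hne0 : ∀ k, k ≠ 0 → bitLin p q r k ≠ 0 := fun k hk => by
    simpa [bitLin_zero] using hne k 0 hk
  have hr' : ∀ k, k ≠ 0 ∧ k ≠ 1 ∧ k ≠ 2 ∧ k ≠ 3 → m (bitLin p q r k) ≤ m r := fun k hk =>
    hrmax _ ⟨hne0 k hk.1, (hne k 1 hk.2.1).trans_eq h1, (hne k 2 hk.2.2.1).trans_eq h2,
      (hne k 3 hk.2.2.2).trans_eq h3⟩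
  have hq' : ∀ k, k ≠ 0 ∧ k ≠ 1 → m (bitLin p q r k) ≤ m q := fun k hk =>
    hqmax _ ⟨hne0 k hk.1, (hne k 1 hk.2).trans_eq h1⟩
  refine ⟨p, q, r, hind, ?_⟩
  simp only [GreedySorted, Function.comp_apply, h1, h2, h4]
  exact ⟨hpmax _ hq, hq' 3 (by decide), hqmax _ ⟨hr, hrp⟩, hr' 5 (by decide), hr' 6 (by decide),
    hr' 7 (by decide)⟩

lemma exists_greedySorted_range_encode_eq {n : ℕ} {C : Submodule (ZMod 2) (Fin n → ZMod 2)}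
    (hC : Module.finrank (ZMod 2) C = 3) :
    ∃ g : Fin n → Fin 8, Function.Injective (encode g) ∧ GreedySorted (mult g) ∧
      LinearMap.range (encode g) = C := by
  obtain ⟨g, hg, rfl⟩ := exists_range_encode_eq hC
  obtain ⟨p, q, r, hind, hs⟩ := exists_greedySorted (mult g)
  let e := Equiv.ofBijective _ hind.bitLin_bijective
  have hge : g = bitLin p q r ∘ (e.symm ∘ g) := funext fun j => (e.apply_symm_apply (g j)).symm
  have hm : mult g ∘ bitLin p q r = mult (e.symm ∘ g) := funext fun k => by
    conv_lhs => rw [Function.comp_apply, hge, mult_comp_bijective _ hind.bitLin_bijective]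
  have hle : LinearMap.range (encode g) ≤ LinearMap.range (encode (e.symm ∘ g)) := by
    conv_lhs => rw [hge]
    exact range_encode_bitLin_le _ p q r
  have hrank : Module.finrank (ZMod 2) (LinearMap.range (encode (e.symm ∘ g))) = 3 :=
    le_antisymm ((LinearMap.finrank_range_le _).trans (by simp))
      (hC.symm.trans_le (Submodule.finrank_mono hle))
  refine ⟨e.symm ∘ g, ?_, hm ▸ hs,
    (Submodule.eq_of_le_of_finrank_eq hle (hC.trans hrank.symm)).symm⟩
  have := LinearMap.finrank_range_add_finrank_ker (encode (e.symm ∘ g))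
  rw [hrank, Module.finrank_fin_fun, Nat.add_eq_left, Submodule.finrank_eq_zero] at this
  exact LinearMap.ker_eq_bot.1 this

lemma exists_eq_bitLin_of_range_encode_le {n : ℕ} {g h : Fin n → Fin 8}
    (H : LinearMap.range (encode h) ≤ LinearMap.range (encode g)) :
    ∃ p q r, h = bitLin p q r ∘ g := by
  have hu : ∀ i : Fin 3, ∃ u, encode g (bitVec u) = encode h (Pi.single i 1) := fun i => by
    obtain ⟨x, hx⟩ := H ⟨Pi.single i 1, rfl⟩
    obtain ⟨u, rfl⟩ := bitVec_bijective.2 x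
    exact ⟨u, hx⟩
  choose u hu using hu
  choose c hc using fun l : Fin 3 => bitVec_bijective.2 fun i => bitVec (u i) l
  refine ⟨c 0, c 1, c 2, funext fun j => bitVec_bijective.1 (funext fun i => ?_)⟩
  have := congrFun (hu i) j
  simp only [encode_apply, single_dotProduct, one_mul] at this
  rw [Function.comp_apply, bitVec_bitLin, hc, hc, hc, ← this, dotProduct, Fin.sum_univ_three]

lemma codeEquiv_range_encode_iff {n : ℕ} {g h : Fin n → Fin 8}
    (hg : Function.Injective (encode g)) (hh : Function.Injective (encode h))
    (hg0 : mult g 0 = 0) (hh0 : mult h 0 = 0) :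
    codeEquiv (LinearMap.range (encode g)) (LinearMap.range (encode h)) ↔
      ColCongr (mult h) (mult g) := by
  rw [codeEquiv_iff_exists_perm, colCongr_iff]
  simp only [map_funLeft_range_encode]
  constructor
  · rintro ⟨σ, hσ⟩
    obtain ⟨p, q, r, rfl⟩ := exists_eq_bitLin_of_range_encode_le hσ.le
    have hind : BitIndep p q r := bitIndep_of_forall_exists fun a ha => by
      obtain ⟨j, hj⟩ := Function.ne_iff.1 ((encode_eq_zero_iff hh a).not.2 ha)
      refine ⟨g (σ j), ?_⟩
      rw [encode_apply, bitVec_dotProduct] at hj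
      by_contra hc
      exact hj (if_neg hc)
    refine ⟨p, q, r, hind, fun k _ => ?_⟩
    rw [mult_comp_bijective _ hind.bitLin_bijective]
    simp only [mult, Function.comp_apply]
    exact Finset.card_equiv σ (by simp)
  · rintro ⟨p, q, r, hind, hk⟩
    obtain ⟨σ, hσ⟩ := exists_perm_of_mult_eq (g := bitLin p q r ∘ g) (h := h) <| by
      funext k
      obtain ⟨k, rfl⟩ := hind.bitLin_bijective.2 k
      rw [mult_comp_bijective _ hind.bitLin_bijective]
      by_cases hk0 : k = 0
      · rw [hk0, bitLin_zero, hg0, hh0]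
      · rw [hk k hk0]
    have hσ' : h = bitLin p q r ∘ (g ∘ σ) := funext fun j => (hσ j).symm
    have hgσ : Function.Injective (encode (g ∘ σ)) := fun x y hxy =>
      hg <| funext fun j => by simpa [encode_apply] using congrFun hxy (σ.symm j)
    refine ⟨σ, Submodule.eq_of_le_of_finrank_eq ?_ ?_⟩
    · rw [hσ']; exact range_encode_bitLin_le _ p q r
    · rw [finrank_range_encode hh, finrank_range_encode hgσ]

/-- Multiplicities, normalised by subtracting a constant, of the nonzero columns of a generator
matrix of an LCD code: their sum is `2 * D` and `D` is the normalised minimum weight. -/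
def IsProfile (D : ℕ) (x : Fin 8 → ℕ) : Prop :=
  x 1 + x 2 + x 3 + x 4 + x 5 + x 6 + x 7 = 2 * D ∧
    (∃ a ≠ 0, colWeight x a = D) ∧ (∀ a ≠ 0, D ≤ colWeight x a) ∧ GramNondeg x

instance (D : ℕ) (x : Fin 8 → ℕ) : Decidable (IsProfile D x) := by
  unfold IsProfile; infer_instance

lemma colWeight_shift {K s : ℕ} {m x : Fin 8 → ℕ} (h : ∀ k ≠ 0, m k + K = s + x k) {a : Fin 8}
    (ha : a ≠ 0) : colWeight m a + 4 * K = 4 * s + colWeight x a := by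
  have hk := fun k : Fin 7 => h k.succ k.succ_ne_zero
  simp only [Fin.forall_fin_succ, IsEmpty.forall_iff] at hk
  simp at hk
  fin_cases a <;> simp [colWeight, Fin.sum_univ_eight, bitDot, Nat.testBit] at ha ⊢ <;> lia

lemma colGram_shift {K s : ℕ} {m x : Fin 8 → ℕ} (h : ∀ k ≠ 0, m k + K = s + x k) (a b : Fin 8) :
    colGram m a b % 2 = colGram x a b % 2 := by
  have hk := fun k : Fin 7 => h k.succ k.succ_ne_zero
  simp [Fin.forall_fin_succ] at hk
  fin_cases a <;> fin_cases b <;>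
    simp [colGram, Fin.sum_univ_eight, bitDot, Nat.testBit] <;> lia

lemma isProfile_iff {n d s K D : ℕ} {m x : Fin 8 → ℕ} (hn : n + 7 * K = 7 * s + 2 * D)
    (hd : d + 4 * K = 4 * s + D) (hm : ∑ k, m k = n) (hm0 : m 0 = 0)
    (h : ∀ k ≠ 0, m k + K = s + x k) :
    IsProfile D x ↔
      ((∃ a ≠ 0, colWeight m a = d) ∧ ∀ a ≠ 0, d ≤ colWeight m a) ∧ GramNondeg m := by
  have hsum : x 1 + x 2 + x 3 + x 4 + x 5 + x 6 + x 7 = 2 * D := by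
    have hk := fun k : Fin 7 => h k.succ k.succ_ne_zero
    simp [Fin.forall_fin_succ] at hk
    rw [Fin.sum_univ_eight] at hm
    lia
  have heq : ∀ a, a ≠ 0 ∧ colWeight m a = d ↔ a ≠ 0 ∧ colWeight x a = D := fun a =>
    and_congr_right fun ha => by have := colWeight_shift h ha; lia
  have hle : ∀ a, (a ≠ 0 → d ≤ colWeight m a) ↔ (a ≠ 0 → D ≤ colWeight x a) := fun a =>
    imp_congr_right fun ha => by have := colWeight_shift h ha; lia
  simp only [IsProfile, GramNondeg, hsum, heq, hle, colGram_shift h, true_and, and_assoc]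

lemma le_mult_add {n d s K D : ℕ} {m : Fin 8 → ℕ} (hn : n + 7 * K = 7 * s + 2 * D)
    (hd : d + 4 * K = 4 * s + D) (hm : ∑ k, m k = n) (hm0 : m 0 = 0)
    (hw : ∀ a ≠ 0, d ≤ colWeight m a) {k : Fin 8} (hk : k ≠ 0) : s ≤ m k + K := by
  simp [Fin.forall_fin_succ, colWeight, Fin.sum_univ_eight, bitDot, Nat.testBit] at hw
  rw [Fin.sum_univ_eight] at hm
  fin_cases k <;> simp at hk ⊢ <;> lia

/-- A list `y` of representatives of all profiles up to linear equivalence gives a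
classification of three-dimensional binary LCD codes. -/
theorem exists_classification {N n d s K D : ℕ} (y : Fin N → Fin 8 → ℕ)
    (hn : n + 7 * K = 7 * s + 2 * D) (hd : d + 4 * K = 4 * s + D)
    (hK : ∀ i, ∀ k ≠ 0, K ≤ s + y i k) (hy : ∀ i, IsProfile D (y i))
    (hdist : ∀ i j, i ≠ j → ¬ ColCongr (y j) (y i))
    (hall : ∀ x, IsProfile D x → GreedySorted x → ∃ i, ColCongr x (y i)) :
    ∃ L : Fin N → Submodule (ZMod 2) (Fin n → ZMod 2),
      (∀ i, Module.finrank (ZMod 2) (L i) = 3 ∧ IsLCD (L i) ∧ HasMinWeight (L i) d ∧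
        DualDistGe (L i) 2) ∧
      (∀ i j, i ≠ j → ¬ codeEquiv (L i) (L j)) ∧
      (∀ C : Submodule (ZMod 2) (Fin n → ZMod 2), Module.finrank (ZMod 2) C = 3 → IsLCD C →
        HasMinWeight C d → DualDistGe C 2 → ∃ i, codeEquiv (L i) C) := by
  have hcol : ∀ i, ∃ g : Fin n → Fin 8, mult g 0 = 0 ∧ ∀ k ≠ 0, mult g k + K = s + y i k := by
    intro i
    obtain ⟨g, hg⟩ := exists_mult_eq (n := n)
      (m := fun k => if k = 0 then 0 else s + y i k - K) <| by
        have hk := fun k : Fin 7 => hK i k.succ k.succ_ne_zero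
        simp [Fin.forall_fin_succ] at hk
        have := (hy i).1
        simp [Fin.sum_univ_eight]
        lia
    refine ⟨g, by simp [hg], fun k hk => ?_⟩
    simpa [hg, hk] using Nat.sub_add_cancel (hK i k hk)
  choose g hg0 hg using hcol
  have hprof := fun i => (isProfile_iff hn hd (sum_mult (g i)) (hg0 i) (hg i)).1 (hy i)
  have hinj := fun i => (hprof i).2.encode_injective
  have hcongr : ∀ (i : Fin N) {h : Fin n → Fin 8} {x : Fin 8 → ℕ},
      Function.Injective (encode h) → mult h 0 = 0 → (∀ k ≠ 0, mult h k + K = s + x k) →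
      (codeEquiv (LinearMap.range (encode (g i))) (LinearMap.range (encode h)) ↔
        ColCongr x (y i)) := by
    intro i h x hh hh0 hx
    rw [codeEquiv_range_encode_iff (hinj i) hh (hg0 i) hh0, colCongr_iff, colCongr_iff]
    refine exists_congr fun p => exists_congr fun q => exists_congr fun r =>
      and_congr_right fun hind => forall₂_congr fun k hk => ?_
    have h1 := hx (bitLin p q r k) fun h0 =>
      hk (hind.bitLin_bijective.1 (h0.trans (bitLin_zero p q r).symm))
    have h2 := hg i k hk
    lia
  refine ⟨fun i => LinearMap.range (encode (g i)), fun i => ⟨finrank_range_encode (hinj i),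
    (isLCD_range_encode_iff (hinj i)).2 (hprof i).2,
    (hasMinWeight_range_encode_iff (hinj i) d).2 (hprof i).1,
    dualDistGe_two_range_encode_iff.2 (hg0 i)⟩,
    fun i j hij => (hcongr i (hinj j) (hg0 j) (hg j)).not.2 (hdist i j hij), ?_⟩
  intro C hC hLCD hmin hdual
  obtain ⟨h, hh, hsort, rfl⟩ := exists_greedySorted_range_encode_eq hC
  rw [isLCD_range_encode_iff hh] at hLCD
  rw [hasMinWeight_range_encode_iff hh] at hmin
  rw [dualDistGe_two_range_encode_iff] at hdual
  have hx : ∀ k ≠ 0, mult h k + K = s + (mult h k + K - s) := fun k hk =>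
    (Nat.add_sub_cancel' (le_mult_add hn hd (sum_mult h) hdual hmin.2 hk)).symm
  obtain ⟨i, hi⟩ := hall (fun k => mult h k + K - s)
    ((isProfile_iff hn hd (sum_mult h) hdual hx).2 ⟨hmin, hLCD⟩)
    (hsort.imp fun hst => Nat.sub_le_sub_right (Nat.add_le_add_right hst K) s)
  exact ⟨i, (hcongr i hh hdual hx).2 hi⟩

lemma forall_isProfile {N D : ℕ} {y : Fin N → Fin 8 → ℕ} (hD : D < 12)
    (H : ∀ a b c : Fin 6, b ≤ a ∧ c ≤ b ∧ (a + b + c : ℕ) ≤ D →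
      ∀ d e : Fin 6, d ≤ b ∧ e ≤ d ∧ (a + d + e : ℕ) ≤ D →
      ∀ f g : Fin 6, f ≤ d ∧ g ≤ d ∧ (a + b + c + d + e + f + g : ℕ) = 2 * D ∧
        (b + d + f : ℕ) ≤ D ∧ (c + e + f : ℕ) ≤ D ∧ (a + f + g : ℕ) ≤ D ∧
        (b + e + g : ℕ) ≤ D ∧ (c + d + g : ℕ) ≤ D →
      GramNondeg ![0, (a : ℕ), b, c, d, e, f, g] →
      ∃ i, ColCongr ![0, (a : ℕ), b, c, d, e, f, g] (y i))
    (x : Fin 8 → ℕ) (hx : IsProfile D x) (hs : GreedySorted x) : ∃ i, ColCongr x (y i) := by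
  obtain ⟨hsum, -, hw, hG⟩ := hx
  have hx' : ∀ k ≠ 0, ![0, x 1, x 2, x 3, x 4, x 5, x 6, x 7] k = x k := by
    simp [Fin.forall_fin_succ]
  have hcongr : ∀ i, ColCongr x (y i) ↔
      ColCongr ![0, x 1, x 2, x 3, x 4, x 5, x 6, x 7] (y i) := fun i => by
    rw [colCongr_iff, colCongr_iff]
    refine exists_congr fun p => exists_congr fun q => exists_congr fun r =>
      and_congr_right fun hind => forall₂_congr fun k hk => ?_
    rw [hx' _ fun h0 => hk (hind.bitLin_bijective.1 (h0.trans (bitLin_zero p q r).symm))]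
  have hG' : GramNondeg ![0, x 1, x 2, x 3, x 4, x 5, x 6, x 7] := fun a ha => by
    obtain ⟨b, hb⟩ := hG a ha
    exact ⟨b, by rw [colGram_shift (K := 0) (s := 0) (x := x) (by simpa using hx'), hb]⟩
  simp only [hcongr]
  simp [Fin.forall_fin_succ, colWeight, Fin.sum_univ_eight, bitDot, Nat.testBit] at hw
  obtain ⟨h21, h32, h42, h54, h64, h74⟩ := hs
  exact H ⟨x 1, by lia⟩ ⟨x 2, by lia⟩ ⟨x 3, by lia⟩ ⟨h21, h32, by lia⟩
    ⟨x 4, by lia⟩ ⟨x 5, by lia⟩ ⟨h42, h54, by lia⟩ ⟨x 6, by lia⟩ ⟨x 7, by lia⟩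
    ⟨h64, h74, hsum, by lia, by lia, by lia, by lia, by lia⟩ hG'

/-- Representatives of the profiles of LCD `[7s+1, 3, 4s-1]` codes. -/
def profiles₁ : Fin 7 → Fin 8 → ℕ :=
  ![![0, 1, 2, 2, 3, 4, 5, 5], ![0, 1, 1, 2, 4, 4, 5, 5], ![0, 1, 2, 3, 3, 4, 4, 5],
    ![0, 2, 2, 3, 3, 3, 4, 5], ![0, 1, 3, 4, 3, 4, 3, 4], ![0, 1, 3, 3, 3, 4, 4, 4],
    ![0, 2, 3, 3, 3, 4, 3, 4]]

/-- Representatives of the profiles of LCD `[7s+4, 3, 4s+1]` codes. -/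
def profiles₄ : Fin 5 → Fin 8 → ℕ :=
  ![![0, 1, 1, 1, 3, 4, 4, 4], ![0, 1, 1, 2, 3, 3, 4, 4], ![0, 1, 2, 3, 2, 3, 3, 4],
    ![0, 1, 2, 2, 3, 3, 3, 4], ![0, 2, 2, 3, 2, 3, 3, 3]]

/-- Representatives of the profiles of LCD `[7s+6, 3, 4s+2]` codes. -/
def profiles₆ : Fin 5 → Fin 8 → ℕ :=
  ![![0, 1, 1, 1, 4, 4, 4, 5], ![0, 1, 2, 2, 3, 3, 4, 5], ![0, 2, 2, 3, 2, 3, 3, 5],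
    ![0, 1, 2, 3, 3, 3, 4, 4], ![0, 2, 2, 3, 3, 3, 3, 4]]

lemma exists_colCongr_profiles₁ :
    ∀ x, IsProfile 11 x → GreedySorted x → ∃ i, ColCongr x (profiles₁ i) :=
  forall_isProfile (by simp) (by decide +kernel)

lemma exists_colCongr_profiles₄ :
    ∀ x, IsProfile 9 x → GreedySorted x → ∃ i, ColCongr x (profiles₄ i) :=
  forall_isProfile (by simp) (by decide +kernel)

lemma exists_colCongr_profiles₆ :
    ∀ x, IsProfile 10 x → GreedySorted x → ∃ i, ColCongr x (profiles₆ i) :=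
  forall_isProfile (by simp) (by decide +kernel)

/-- (i) For every `s ≥ 2` there are exactly `7` equivalence classes of binary optimal LCD
`[7s+1, 3, 4s−1]` codes with dual distance `≥ 2`; (ii) for `t ∈ {4,6}` and every `s ≥ 1`
there are exactly `5` equivalence classes of binary optimal LCD `[7s+t, 3, d₂(7s+t,3)]`
codes with dual distance `≥ 2`, where `d₂(7s+4,3) = 4s+1` and `d₂(7s+6,3) = 4s+2`. -/
theorem classification_binary_dim3 :
    (∀ s : ℕ, 2 ≤ s →
      ∃ L : Fin 7 → Submodule (ZMod 2) (Fin (7 * s + 1) → ZMod 2),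
        (∀ i, Module.finrank (ZMod 2) (L i) = 3 ∧ IsLCD (L i) ∧
          HasMinWeight (L i) (4 * s - 1) ∧ DualDistGe (L i) 2) ∧
        (∀ i j, i ≠ j → ¬ codeEquiv (L i) (L j)) ∧
        (∀ C : Submodule (ZMod 2) (Fin (7 * s + 1) → ZMod 2),
          Module.finrank (ZMod 2) C = 3 → IsLCD C → HasMinWeight C (4 * s - 1) →
          DualDistGe C 2 → ∃ i, codeEquiv (L i) C)) ∧
    (∀ t : ℕ, t = 4 ∨ t = 6 → ∀ s : ℕ, 1 ≤ s →
      ∃ L : Fin 5 → Submodule (ZMod 2) (Fin (7 * s + t) → ZMod 2),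
        (∀ i, Module.finrank (ZMod 2) (L i) = 3 ∧ IsLCD (L i) ∧
          HasMinWeight (L i) (if t = 4 then 4 * s + 1 else 4 * s + 2) ∧
          DualDistGe (L i) 2) ∧
        (∀ i j, i ≠ j → ¬ codeEquiv (L i) (L j)) ∧
        (∀ C : Submodule (ZMod 2) (Fin (7 * s + t) → ZMod 2),
          Module.finrank (ZMod 2) C = 3 → IsLCD C →
          HasMinWeight C (if t = 4 then 4 * s + 1 else 4 * s + 2) →
          DualDistGe C 2 → ∃ i, codeEquiv (L i) C)) := by
  have pos₁ : ∀ i, ∀ k ≠ 0, 1 ≤ profiles₁ i k := by decide +kernel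
  have pos₄ : ∀ i, ∀ k ≠ 0, 1 ≤ profiles₄ i k := by decide +kernel
  have pos₆ : ∀ i, ∀ k ≠ 0, 1 ≤ profiles₆ i k := by decide +kernel
  refine ⟨fun s hs => exists_classification (s := s) (K := 3) (D := 11) profiles₁ (by lia) (by lia)
    (fun i k hk => by have := pos₁ i k hk; lia) (by decide +kernel) (by decide +kernel)
    exists_colCongr_profiles₁, ?_⟩
  rintro t (rfl | rfl) s hs
  · exact exists_classification (s := s) (K := 2) (D := 9) profiles₄ (by lia) (by simp)
      (fun i k hk => by have := pos₄ i k hk; lia) (by decide +kernel) (by decide +kernel)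
      exists_colCongr_profiles₄
  · exact exists_classification (s := s) (K := 2) (D := 10) profiles₆ (by lia) (by simp)
      (fun i k hk => by have := pos₆ i k hk; lia) (by decide +kernel) (by decide +kernel)
      exists_colCongr_profiles₆
end
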